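/- Let A be an integral domain which is finitely generated as a ℤ-algebra, let n be a natural number, and let M ∈ GL(n, A) with M ≠ 1 (M is not the identity matrix). Then there exists a maximal ideal m of A such that the residue field A/m is finite and the image of M under the reduction homomorphism GL(n, A) → GL(n, A/m) is not the identity. -/

import Mathlib

theorem int_jacobson_aux : IsJacobsonRing ℤ := by
  rw [isJacobsonRing_iff_prime_eq]
  intro P hP
  by_cases h : P = ⊥
  · subst h
    refine le_antisymm ?_ Ideal.le_jacobson
    intro x hx
    rw [Ideal.mem_jacobson_bot] at hx
    have h1 := Int.isUnit_iff.1 (hx x)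
    rw [Ideal.mem_bot]
    rcases h1 with h1 | h1
    · have : x * x = 0 := by linarith
      simpa using this
    · nlinarith [mul_self_nonneg x]
  · have := hP.isMaximal h
    exact Ideal.jacobson_eq_self_of_isMaximal

theorem finite_field_aux (K : Type) [Field K] [Algebra.FiniteType ℤ K] : Finite K := by
  have := int_jacobson_aux
  have hf : Module.Finite ℤ K := finite_of_finite_type_of_isJacobsonRing ℤ K
  obtain ⟨p, hp⟩ := CharP.exists K
  rcases CharP.char_is_prime_or_zero K p with h | h
  · haveI : Fact p.Prime := ⟨h⟩
    letI := ZMod.algebra K p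
    have : Module.Finite (ZMod p) K := Module.Finite.of_restrictScalars_finite ℤ (ZMod p) K
    exact Module.finite_of_finite (ZMod p)
  · subst h
    haveI : CharZero K := CharP.charP_to_charZero K
    have hi : Function.Injective (algebraMap ℤ K) := by
      simpa using (Int.cast_injective (α := K))
    exact absurd (isField_of_isIntegral_of_isField hi (Field.toIsField K)) Int.not_isField

theorem finite_field_aux' {A K : Type} [CommRing A] [Field K] (hA : Algebra.FiniteType ℤ A)
    (f : A →+* K) (hf : Function.Surjective f) : Finite K := by
  have : Algebra.FiniteType ℤ K := hA.of_surjective f.toIntAlgHom hf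
  exact finite_field_aux K

/-- If `A` is an integral domain of finite type over `ℤ` and `M ∈ GL(n, A)` is
not the identity, then there is a maximal ideal `m ⊆ A` with finite residue
field such that the reduction of `M` modulo `m` is not the identity. -/
theorem stmt2 (A : Type) [CommRing A] [IsDomain A] (hA : Algebra.FiniteType ℤ A)
    (n : ℕ) (M : Matrix.GeneralLinearGroup (Fin n) A) (hM : M ≠ 1) :
    ∃ m : Ideal A, m.IsMaximal ∧ Finite (A ⧸ m) ∧
      Units.map ((Ideal.Quotient.mk m).mapMatrix).toMonoidHom M ≠ 1 := by
  have := int_jacobson_aux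
  have hJ : IsJacobsonRing A := isJacobsonRing_of_finiteType (A := ℤ)
  by_contra hcon
  push Not at hcon
  apply hM
  ext i j
  have hb : (⊥ : Ideal A).jacobson = ⊥ :=
    (isJacobsonRing_iff_prime_eq.1 hJ) ⊥ Ideal.isPrime_bot
  have hmem : M.val i j - (1 : Matrix (Fin n) (Fin n) A) i j ∈ (⊥ : Ideal A).jacobson := by
    rw [Ideal.jacobson, Ideal.mem_sInf]
    rintro m ⟨-, hm⟩
    have hfin : Finite (A ⧸ m) := by
      letI := Ideal.Quotient.field m
      exact finite_field_aux' hA (Ideal.Quotient.mk m) Ideal.Quotient.mk_surjective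
    have h1 := congrArg (fun u => u.val i j) (hcon m hm hfin)
    have h2 : Ideal.Quotient.mk m (M.val i j) = (1 : Matrix (Fin n) (Fin n) (A ⧸ m)) i j := h1
    rw [← Ideal.Quotient.eq, h2, Matrix.one_apply, Matrix.one_apply]
    split_ifs <;> simp
  rw [hb, Ideal.mem_bot, sub_eq_zero] at hmem
  exact hmem
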